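/- Let q = p^h with p prime and h ≥ 1. There exist real constants A > 0 and ε > 0 such that for every function k : ℕ → ℕ satisfying k(n) ≤ n for all n and lim_{n→∞} ( n²/4 − ε·n + A·√n − k(n)·(n − k(n)) ) = −∞ (condition (⋆)), the number N^Γ_{k(n),n} of semilinear equivalence classes of k(n)-dimensional linear codes in F_q^n satisfies N^Γ_{k(n),n} ∼ q^{k(n)·(n − k(n))} / ( K_q · h · n! · (q−1)^{n−1} ) as n → ∞. -/

import Mathlib

open Filter Matrix
open scoped Topology

/-- The `q`-binomial coefficient `binom(n,k)_q = ∏_{j=0}^{k-1} (q^{n-j}-1)/(q^{k-j}-1)`. -/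
noncomputable def qBinom (q n k : ℕ) : ℝ :=
  ∏ j ∈ Finset.range k, ((q : ℝ) ^ (n - j) - 1) / ((q : ℝ) ^ (k - j) - 1)

/-- `S(n) = ∑_{k=0}^n binom(n,k)_q`. -/
noncomputable def Sq (q n : ℕ) : ℝ := ∑ k ∈ Finset.range (n + 1), qBinom q n k

/-- `K_q = ∏_{j=1}^∞ (1 - q^{-j})`. -/
noncomputable def Kq (q : ℕ) : ℝ := ∏' j : ℕ, (1 - ((q : ℝ))⁻¹ ^ (j + 1))

/-- `K_q(k) = ∏_{j=1}^{k} (1 - q^{-j})`. -/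
noncomputable def KqTrunc (q k : ℕ) : ℝ := ∏ j ∈ Finset.range k, (1 - ((q : ℝ))⁻¹ ^ (j + 1))

/-- Jacobi theta constant `θ₂(w) = ∑_{k∈ℤ} w^{(k+1/2)²}`. -/
noncomputable def theta2 (w : ℝ) : ℝ := ∑' k : ℤ, w ^ (((k : ℝ) + 1/2) ^ 2)

/-- Jacobi theta constant `θ₃(w) = ∑_{k∈ℤ} w^{k²}`. -/
noncomputable def theta3 (w : ℝ) : ℝ := ∑' k : ℤ, w ^ ((k : ℝ) ^ 2)

/-- Condition (⋆): `n²/4 − ε·n + A·√n − k(n)(n−k(n)) → −∞`. -/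
def StarCond (A ε : ℝ) (k : ℕ → ℕ) : Prop :=
  Tendsto (fun n : ℕ =>
    (n : ℝ) ^ 2 / 4 - ε * n + A * Real.sqrt n - (k n : ℝ) * ((n : ℝ) - (k n : ℝ)))
    atTop atBot

/-- The set of permutation matrices inside `GL n F`. -/
def permSet (F : Type) [Field F] (n : ℕ) : Set (GL (Fin n) F) :=
  {M | ∃ σ : Equiv.Perm (Fin n), (M : Matrix (Fin n) (Fin n) F) = σ.permMatrix F}

/-- The set of invertible diagonal matrices inside `GL n F`. -/
def diagSet (F : Type) [Field F] (n : ℕ) : Set (GL (Fin n) F) :=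
  {M | ∃ d : Fin n → F, (M : Matrix (Fin n) (Fin n) F) = Matrix.diagonal d}

/-- The permutation group: subgroup of `GL n F` formed by the permutation matrices. -/
def PermGroup (F : Type) [Field F] (n : ℕ) : Subgroup (GL (Fin n) F) :=
  Subgroup.closure (permSet F n)

/-- The monomial group: subgroup of `GL n F` generated by permutation and diagonal matrices. -/
def MonomialGroup (F : Type) [Field F] (n : ℕ) : Subgroup (GL (Fin n) F) :=
  Subgroup.closure (permSet F n ∪ diagSet F n)

/-- Number of orbits of a subgroup `G ≤ GL n F` acting on the Grassmannian of
`k`-dimensional subspaces of `F^n` (by taking images of subspaces). -/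
noncomputable def numClassesDim {n : ℕ} (F : Type) [Field F]
    (G : Subgroup (GL (Fin n) F)) (k : ℕ) : ℕ :=
  Nat.card (Quot (fun V W : {V : Submodule F (Fin n → F) // Module.finrank F V = k} =>
    ∃ M ∈ G, Submodule.map (Matrix.toLin' (M : Matrix (Fin n) (Fin n) F)) V.1 = W.1))

/-- Number of orbits of a subgroup `G ≤ GL n F` acting on the set of all subspaces of `F^n`. -/
noncomputable def numClasses {n : ℕ} (F : Type) [Field F]
    (G : Subgroup (GL (Fin n) F)) : ℕ :=
  Nat.card (Quot (fun V W : Submodule F (Fin n → F) =>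
    ∃ M ∈ G, Submodule.map (Matrix.toLin' (M : Matrix (Fin n) (Fin n) F)) V = W))

/-- Semilinear orbit relation: `W` is the image of `V` under the semilinear transformation
given by applying the field automorphism `σ` componentwise followed by a monomial matrix. -/
def semiRel (F : Type) [Field F] (n : ℕ) (V W : Submodule F (Fin n → F)) : Prop :=
  ∃ σ : F ≃+* F, ∃ M ∈ MonomialGroup F n,
    (W : Set (Fin n → F)) =
      (fun x => Matrix.mulVec (M : Matrix (Fin n) (Fin n) F) (fun i => σ (x i))) '' (V : Set (Fin n → F))

/-- Number of semilinear equivalence classes of `k`-dimensional subspaces of `F^n`. -/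
noncomputable def numClassesDimSemi (F : Type) [Field F] (n k : ℕ) : ℕ :=
  Nat.card (Quot (fun V W : {V : Submodule F (Fin n → F) // Module.finrank F V = k} =>
    semiRel F n V.1 W.1))

/-- Number of semilinear equivalence classes of subspaces of `F^n`. -/
noncomputable def numClassesSemi (F : Type) [Field F] (n : ℕ) : ℕ :=
  Nat.card (Quot (fun V W : Submodule F (Fin n → F) => semiRel F n V W))

section KqFacts

variable {q : ℕ}

lemma summable_inv_pow_succ (hq : 2 ≤ q) : Summable fun j : ℕ => ((q : ℝ))⁻¹ ^ (j + 1) := by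
  have h : ((q : ℝ))⁻¹ < 1 := inv_lt_one_of_one_lt₀ (by exact_mod_cast hq)
  exact (summable_nat_add_iff 1).2 (summable_geometric_of_lt_one (by positivity) h)

lemma one_sub_inv_pow_mem (hq : 2 ≤ q) (j : ℕ) :
    0 < 1 - ((q : ℝ))⁻¹ ^ (j + 1) ∧ 1 - ((q : ℝ))⁻¹ ^ (j + 1) ≤ 1 := by
  have h : ((q : ℝ))⁻¹ < 1 := inv_lt_one_of_one_lt₀ (by exact_mod_cast hq)
  have h0 : 0 ≤ ((q : ℝ))⁻¹ := by positivity
  have := pow_lt_one₀ h0 h (Nat.succ_ne_zero j)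
  exact ⟨by simpa using this, by simp⟩

lemma multipliable_Kq (hq : 2 ≤ q) : Multipliable fun j : ℕ => (1 - ((q : ℝ))⁻¹ ^ (j + 1)) := by
  simp only [sub_eq_add_neg]
  exact Real.multipliable_one_add_of_summable (summable_inv_pow_succ hq).neg

lemma tendsto_KqTrunc (hq : 2 ≤ q) : Tendsto (KqTrunc q) atTop (𝓝 (Kq q)) :=
  (multipliable_Kq hq).hasProd.tendsto_prod_nat

lemma KqTrunc_pos (hq : 2 ≤ q) (k : ℕ) : 0 < KqTrunc q k :=
  Finset.prod_pos fun j _ => (one_sub_inv_pow_mem hq j).1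

lemma KqTrunc_antitone (hq : 2 ≤ q) : Antitone (KqTrunc q) := by
  refine antitone_nat_of_succ_le fun k => ?_
  rw [KqTrunc, Finset.prod_range_succ]
  exact mul_le_of_le_one_right (KqTrunc_pos hq k).le (one_sub_inv_pow_mem hq k).2

lemma Kq_pos (hq : 2 ≤ q) : 0 < Kq q := by
  have h0 : 0 ≤ Kq q := ge_of_tendsto' (tendsto_KqTrunc hq) fun k => (KqTrunc_pos hq k).le
  refine lt_of_le_of_ne h0 (Ne.symm ?_)
  have := tprod_one_add_ne_zero_of_summable (f := fun j : ℕ => -(((q : ℝ))⁻¹ ^ (j + 1)))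
    (fun j => by have := (one_sub_inv_pow_mem hq j).1; rw [← sub_eq_add_neg]; exact this.ne')
    (by simpa using summable_inv_pow_succ hq)
  simpa only [Kq, sub_eq_add_neg] using this

lemma Kq_le_KqTrunc (hq : 2 ≤ q) (k : ℕ) : Kq q ≤ KqTrunc q k :=
  (KqTrunc_antitone hq).le_of_tendsto (tendsto_KqTrunc hq) k

lemma KqTrunc_le_one (hq : 2 ≤ q) (k : ℕ) : KqTrunc q k ≤ 1 := by
  simpa [KqTrunc] using KqTrunc_antitone hq (Nat.zero_le k)

end KqFacts

section Grassmannian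

variable {F E : Type*} [Field F] [Fintype F] [AddCommGroup E] [Module F E] [Finite E]

open Module

/-- Ordered bases of the members of the Grassmannian are the independent families. -/
noncomputable def linIndepEquivSigma (j : ℕ) :
    {s : Fin j → E // LinearIndependent F s} ≃
      Σ W : {W : Submodule F E // finrank F W = j}, {s : Fin j → W.1 // LinearIndependent F s} where
  toFun s := ⟨⟨Submodule.span F (Set.range s.1), by rw [finrank_span_eq_card s.2]; simp⟩,
    ⟨fun i => ⟨s.1 i, Submodule.subset_span ⟨i, rfl⟩⟩, by
      exact LinearIndependent.of_comp (Submodule.subtype _) s.2⟩⟩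
  invFun p := ⟨fun i => p.2.1 i, p.2.2.map' p.1.1.subtype (Submodule.ker_subtype _)⟩
  left_inv s := rfl
  right_inv := by
    rintro ⟨⟨W, hW⟩, s, hs⟩
    have ext : ∀ (W W' : {W : Submodule F E // finrank F W = j}) (_ : W = W')
        (s : {s : Fin j → W.1 // LinearIndependent F s})
        (s' : {s : Fin j → W'.1 // LinearIndependent F s}),
        (∀ i, (s.1 i : E) = s'.1 i) →
        (⟨W, s⟩ : Σ W : {W : Submodule F E // finrank F W = j},
          {s : Fin j → W.1 // LinearIndependent F s}) = ⟨W', s'⟩ := by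
      rintro W _ rfl s s' h
      congr 1
      exact Subtype.ext (funext fun i => Subtype.ext (h i))
    refine ext _ _ (Subtype.ext ?_) _ _ fun i => rfl
    change Submodule.span F (Set.range fun i => (s i : E)) = W
    have : LinearIndependent F fun i => (s i : E) :=
      hs.map' W.subtype (Submodule.ker_subtype _)
    apply Submodule.eq_of_le_of_finrank_eq
    · rw [Submodule.span_le]; rintro _ ⟨i, rfl⟩; exact (s i).2
    · rw [finrank_span_eq_card this, hW]; simp

lemma card_grassmannian_mul (j : ℕ) (hj : j ≤ finrank F E) :
    Nat.card {W : Submodule F E // finrank F W = j} *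
      ∏ i : Fin j, (Fintype.card F ^ j - Fintype.card F ^ i.val) =
      ∏ i : Fin j, (Fintype.card F ^ finrank F E - Fintype.card F ^ i.val) := by
  classical
  have := Fintype.ofFinite {W : Submodule F E // finrank F W = j}
  rw [← card_linearIndependent hj, Nat.card_congr (linIndepEquivSigma j), Nat.card_sigma]
  have : ∀ W : {W : Submodule F E // finrank F W = j},
      Nat.card {s : Fin j → W.1 // LinearIndependent F s} =
      ∏ i : Fin j, (Fintype.card F ^ j - Fintype.card F ^ i.val) := fun W => by
    rw [card_linearIndependent W.2.ge, W.2]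
  simp [this, Nat.card_eq_fintype_card]

lemma prod_pow_sub_pow {q : ℕ} (hq : 2 ≤ q) {j d : ℕ} (hj : j ≤ d) :
    ((∏ i : Fin j, (q ^ d - q ^ i.val) : ℕ) : ℝ) * KqTrunc q (d - j) =
      (q : ℝ) ^ (d * j) * KqTrunc q d := by
  induction j with
  | zero => simp
  | succ j ih =>
    have ih := ih (by omega)
    rw [Fin.prod_univ_castSucc]
    have hs : d - j = d - (j + 1) + 1 := by omega
    rw [hs, KqTrunc, Finset.prod_range_succ, ← KqTrunc, ← hs] at ih
    have hq0 : (q : ℝ) ≠ 0 := by positivity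
    have h1 : (((q ^ d - q ^ j : ℕ) : ℕ) : ℝ) = (q : ℝ) ^ d * (1 - ((q : ℝ))⁻¹ ^ (d - j)) := by
      rw [Nat.cast_sub (Nat.pow_le_pow_right (by omega) (by omega))]
      obtain ⟨e, rfl⟩ : ∃ e, d = j + e := ⟨d - j, by omega⟩
      simp only [Nat.add_sub_cancel_left, inv_pow]
      push_cast
      field_simp
      ring
    simp only [Fin.val_castSucc, Fin.val_last, Nat.cast_mul, h1]
    linear_combination (q : ℝ) ^ d * ih

lemma card_grassmannian {q : ℕ} (hF : Fintype.card F = q) (j : ℕ) (hj : j ≤ finrank F E) :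
    (Nat.card {W : Submodule F E // finrank F W = j} : ℝ) =
      (q : ℝ) ^ (j * (finrank F E - j)) * (KqTrunc q (finrank F E) /
        (KqTrunc q (finrank F E - j) * KqTrunc q j)) := by
  have hq : 2 ≤ q := hF ▸ Fintype.one_lt_card
  have h1 := congrArg (Nat.cast (R := ℝ)) (card_grassmannian_mul (F := F) (E := E) j hj)
  rw [hF, Nat.cast_mul] at h1
  have h2 := prod_pow_sub_pow hq hj
  have h3 := prod_pow_sub_pow hq (le_refl j)
  rw [← h1] at h2
  have h0 : KqTrunc q (j - j) = 1 := by simp [KqTrunc]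
  rw [h0, mul_one] at h3
  rw [h3] at h2
  have p1 := KqTrunc_pos hq (finrank F E - j)
  have p2 := KqTrunc_pos hq j
  have hq0 : (q : ℝ) ≠ 0 := by positivity
  obtain ⟨e, he⟩ : ∃ e, finrank F E = j + e := ⟨finrank F E - j, by omega⟩
  rw [he] at h2 p1 ⊢
  simp only [Nat.add_sub_cancel_left] at h2 p1 ⊢
  field_simp
  have h4 : (q : ℝ) ^ ((j + e) * j) = q ^ (j * j) * q ^ (j * e) := by rw [← pow_add]; ring_nf
  rw [h4] at h2
  have : (q : ℝ) ^ (j * j) ≠ 0 := by positivity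
  apply mul_left_cancel₀ this
  linear_combination h2

lemma card_grassmannian_le {q : ℕ} (hF : Fintype.card F = q) (j : ℕ) (hj : j ≤ finrank F E) :
    (Nat.card {W : Submodule F E // finrank F W = j} : ℝ) ≤
      (q : ℝ) ^ (j * (finrank F E - j)) / Kq q := by
  have hq : 2 ≤ q := hF ▸ Fintype.one_lt_card
  rw [card_grassmannian hF j hj, div_eq_mul_one_div (_ ^ _) (Kq q)]
  refine mul_le_mul_of_nonneg_left ?_ (by positivity)
  rw [div_le_div_iff₀ (mul_pos (KqTrunc_pos hq _) (KqTrunc_pos hq _)) (Kq_pos hq), one_mul]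
  have := KqTrunc_antitone hq (Nat.sub_le (finrank F E) j)
  exact mul_le_mul this (Kq_le_KqTrunc hq j) (Kq_pos hq).le (KqTrunc_pos hq _).le

lemma card_submodule_le {q : ℕ} (hF : Fintype.card F = q) :
    (Nat.card (Submodule F E) : ℝ) ≤
      (finrank F E + 1) * ((q : ℝ) ^ ((finrank F E : ℝ) ^ 2 / 4) / Kq q) := by
  have hq : 2 ≤ q := hF ▸ Fintype.one_lt_card
  set d := finrank F E
  let e : Submodule F E ≃ Σ j : Fin (d + 1), {W : Submodule F E // finrank F W = j.val} :=
    { toFun W := ⟨⟨finrank F W, Nat.lt_succ_of_le W.finrank_le⟩, W, rfl⟩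
      invFun p := p.2.1
      left_inv _ := rfl
      right_inv := by
        rintro ⟨j, W, hW⟩
        obtain rfl : (⟨finrank F W, Nat.lt_succ_of_le W.finrank_le⟩ : Fin (d + 1)) = j :=
          Fin.ext hW
        rfl }
  rw [Nat.card_congr e, Nat.card_sigma, Nat.cast_sum]
  refine (Finset.sum_le_card_nsmul _ _ ((q : ℝ) ^ ((d : ℝ) ^ 2 / 4) / Kq q) ?_).trans ?_
  · rintro ⟨j, hj⟩ -
    refine (card_grassmannian_le hF j (Nat.lt_succ_iff.1 hj)).trans ?_
    have := Kq_pos hq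
    gcongr
    rw [← Real.rpow_natCast]
    apply Real.rpow_le_rpow_of_exponent_le
    · exact_mod_cast (by omega : 1 ≤ q)
    · rw [Nat.cast_mul, Nat.cast_sub (Nat.lt_succ_iff.1 hj)]
      nlinarith [sq_nonneg ((d : ℝ) - 2 * j)]
  · simp

end Grassmannian

section Invariant

variable {F E : Type*} [Field F] [Fintype F] [AddCommGroup E] [Module F E] [Finite E]

open Module

/-- The upper bound of `card_submodule_le` for the number of subspaces of a `d`-dimensional space. -/
noncomputable def subspaceBound (q d : ℕ) : ℝ := (d + 1) * ((q : ℝ) ^ ((d : ℝ) ^ 2 / 4) / Kq q)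

lemma subspaceBound_nonneg {q : ℕ} (hq : 2 ≤ q) (d : ℕ) : 0 ≤ subspaceBound q d := by
  have := Kq_pos hq
  unfold subspaceBound; positivity

lemma subspaceBound_mono {q : ℕ} (hq : 2 ≤ q) : Monotone (subspaceBound q) := by
  intro a b hab
  have := Kq_pos hq
  unfold subspaceBound
  gcongr
  exact_mod_cast (by omega : 1 ≤ q)

omit [Fintype F] in
lemma finrank_comap_le (N : E →ₗ[F] E) (U : Submodule F E) :
    finrank F (U.comap N) ≤ finrank F U + finrank F (LinearMap.ker N) := by
  set X := U.comap N
  have h2 := LinearMap.finrank_range_add_finrank_ker (N.domRestrict X)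
  have h3 : finrank F (LinearMap.range (N.domRestrict X)) ≤ finrank F U := by
    apply Submodule.finrank_mono
    rintro _ ⟨x, rfl⟩
    exact x.2
  have h4 : finrank F (LinearMap.ker (N.domRestrict X)) ≤ finrank F (LinearMap.ker N) := by
    refine LinearMap.finrank_le_finrank_of_injective
      (f := (X.subtype.restrict (p := LinearMap.ker (N.domRestrict X)) (q := LinearMap.ker N)
        (fun x hx => hx))) ?_
    rintro ⟨x, _⟩ ⟨y, _⟩ h
    exact Subtype.ext (Subtype.ext (congrArg (fun z => (z.1 : E)) h))
  omega

omit [Fintype F] in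
lemma finrank_map_mkQ_le {N : E →ₗ[F] E} {U : Submodule F E} (hU : U ≤ U.comap N) :
    finrank F ((U.comap N).map U.mkQ) ≤ finrank F (LinearMap.ker N) := by
  have h2 := finrank_comap_le N U
  set X := U.comap N
  have h1 := LinearMap.finrank_range_add_finrank_ker (U.mkQ.domRestrict X)
  have h5 : finrank F U ≤ finrank F (LinearMap.ker (U.mkQ.domRestrict X)) := by
    refine LinearMap.finrank_le_finrank_of_injective
      (f := LinearMap.codRestrict _ (Submodule.inclusion hU) (fun x => by
        simp [LinearMap.mem_ker, LinearMap.domRestrict_apply])) ?_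
    rintro ⟨x, _⟩ ⟨y, _⟩ h
    exact Subtype.ext (congrArg (fun z => (z.1.1 : E)) h)
  have h6 : LinearMap.range (U.mkQ.domRestrict X) = X.map U.mkQ := by
    rw [LinearMap.range_domRestrict]
  rw [h6] at h1
  omega

lemma card_invariant_le {q : ℕ} (hF : Fintype.card F = q) (N : E →ₗ[F] E) :
    (Nat.card {V : Submodule F E // V ≤ V.comap N} : ℝ) ≤
      subspaceBound q (finrank F (LinearMap.range N)) *
        subspaceBound q (finrank F (LinearMap.ker N)) := by
  classical
  have hq : 2 ≤ q := hF ▸ Fintype.one_lt_card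
  let R := LinearMap.range N
  let Q : Submodule F R → Type _ := fun U =>
    Submodule F (((U.map R.subtype).comap N).map (U.map R.subtype).mkQ)
  let A := {U : Submodule F R // U.map R.subtype ≤ (U.map R.subtype).comap N}
  have hinf (V : Submodule F E) : (V.comap R.subtype).map R.subtype = R ⊓ V :=
    Submodule.map_comap_subtype _ _
  let f : {V : Submodule F E // V ≤ V.comap N} → Σ U : A, Q U.1 := fun V =>
    ⟨⟨V.1.comap R.subtype, by
      rw [hinf]
      exact fun x hx => ⟨⟨x, rfl⟩, V.2 hx.2⟩⟩,
      (V.1.map ((V.1.comap R.subtype).map R.subtype).mkQ).comap (Submodule.subtype _)⟩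
  have hf : Function.Injective f := by
    intro V W h
    have h1 : V.1.comap R.subtype = W.1.comap R.subtype :=
      congrArg (fun z => z.1.1) h
    have key : ∀ V : {V : Submodule F E // V ≤ V.comap N},
        V.1 = (((f V).2.map (Submodule.subtype _)).comap
          ((f V).1.1.map R.subtype).mkQ) := by
      intro V
      simp only [f, Submodule.map_comap_subtype]
      rw [inf_eq_right.2, Submodule.comap_map_mkQ, sup_eq_right.2]
      · rw [hinf]; exact inf_le_right
      · apply Submodule.map_mono
        intro x hx
        exact show N x ∈ R ⊓ V.1 from ⟨⟨x, rfl⟩, V.2 hx⟩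
    apply Subtype.ext
    rw [key V, key W, h]
  have hfin : ∀ U : Submodule F E, Finite (E ⧸ U) := fun U =>
    Finite.of_surjective _ U.mkQ_surjective
  have : ∀ U : A, Finite (Q U.1) := fun U => by dsimp only [Q]; infer_instance
  have := Fintype.ofFinite A
  calc (Nat.card {V : Submodule F E // V ≤ V.comap N} : ℝ)
      ≤ Nat.card (Σ U : A, Q U.1) := by exact_mod_cast Nat.card_le_card_of_injective f hf
    _ = ∑ U : A, (Nat.card (Q U.1) : ℝ) := by
        rw [Nat.card_sigma]; push_cast; rfl
    _ ≤ ∑ U : A, subspaceBound q (finrank F (LinearMap.ker N)) := by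
        refine Finset.sum_le_sum fun U _ => ?_
        exact (card_submodule_le hF).trans (subspaceBound_mono hq (finrank_map_mkQ_le U.2))
    _ = Nat.card A * subspaceBound q (finrank F (LinearMap.ker N)) := by
        simp [Nat.card_eq_fintype_card]
    _ ≤ _ := by
        refine mul_le_mul_of_nonneg_right ?_ (subspaceBound_nonneg hq _)
        refine le_trans ?_ (card_submodule_le (E := R) hF)
        exact_mod_cast Nat.card_le_card_of_injective _ Subtype.val_injective

end Invariant

section Generation

variable {F E : Type*} [Field F] [AddCommGroup E] [Module F E] [Fintype E]

open Module Finset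

/-- `x` and `g x` are linearly independent modulo `W`. -/
def IsFresh (F : Type*) {E : Type*} [Field F] [AddCommGroup E] [Module F E]
    (g : E → E) (W : Submodule F E) (x : E) : Prop :=
  x ∉ W ∧ g x ∉ W ⊔ Submodule.span F {x}

open Classical in
lemma card_filter_le_pow (S : Finset (Submodule F E)) {k : ℕ} (hS : ∀ V ∈ S, finrank F V = k)
    (m : ℕ) (W : Submodule F E) (hW : k ≤ finrank F W + m) :
    #{V ∈ S | W ≤ V} ≤ Fintype.card E ^ m := by
  induction m generalizing W with
  | zero =>
    rw [pow_zero, card_le_one]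
    have key : ∀ V ∈ S.filter (W ≤ ·), W = V := fun V hV =>
      Submodule.eq_of_le_of_finrank_le (mem_filter.1 hV).2
        ((hS V (mem_filter.1 hV).1).trans_le hW)
    exact fun V hV V' hV' => (key V hV).symm.trans (key V' hV')
  | succ m ih =>
    by_cases hk : k ≤ finrank F W
    · exact (ih W (by omega)).trans (Nat.pow_le_pow_right Fintype.card_pos (by omega))
    calc #{V ∈ S | W ≤ V}
        ≤ #((univ : Finset E).filter (· ∉ W) |>.biUnion fun x =>
            {V ∈ S | W ⊔ Submodule.span F {x} ≤ V}) := by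
          refine card_le_card fun V hV => ?_
          obtain ⟨hVS, hWV⟩ := mem_filter.1 hV
          have : W < V := lt_of_le_of_ne hWV (by
            rintro rfl
            exact hk (hS _ hVS).ge)
          obtain ⟨x, hxV, hxW⟩ := SetLike.exists_of_lt this
          simp only [mem_biUnion, mem_filter, mem_univ, true_and]
          exact ⟨x, hxW, hVS, sup_le hWV ((Submodule.span_singleton_le_iff_mem _ _).2 hxV)⟩
      _ ≤ ∑ x ∈ (univ : Finset E).filter (· ∉ W), Fintype.card E ^ m := by
          refine card_biUnion_le.trans (sum_le_sum fun x hx => ih _ ?_)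
          rw [Submodule.finrank_sup_span_singleton (mem_filter.1 hx).2]
          omega
      _ ≤ Fintype.card E ^ (m + 1) := by
          rw [sum_const, smul_eq_mul, pow_succ, mul_comm]
          exact Nat.mul_le_mul_left _ (card_le_univ _)

open Classical in
/-- If every member `V` of `S` has at least `L` vectors `x` for which `x, g x` are independent
modulo any given small subspace of `V`, then few vectors generate `V`, so `S` is small. -/
lemma card_filter_mul_pow_le (g : E → E) (S : Finset (Submodule F E)) {k κ L : ℕ}
    (hS : ∀ V ∈ S, finrank F V = k) (hg : ∀ V ∈ S, ∀ x ∈ V, g x ∈ V)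
    (hL : ∀ V ∈ S, ∀ W ≤ V, finrank F W + 2 + κ ≤ k → L ≤ #{x | x ∈ V ∧ IsFresh F g W x})
    (t : ℕ) (W : Submodule F E) (hW : finrank F W + 2 * t + κ ≤ k) :
    #{V ∈ S | W ≤ V} * L ^ t ≤ Fintype.card E ^ (k - finrank F W - t) := by
  induction t generalizing W with
  | zero => simpa using card_filter_le_pow S hS (k - finrank F W) W (by omega)
  | succ t ih =>
    set C := S.filter (W ≤ ·)
    have h1 : #C * L ≤ ∑ V ∈ C, #{x | x ∈ V ∧ IsFresh F g W x} := by
      rw [← smul_eq_mul]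
      refine card_nsmul_le_sum _ _ _ fun V hV => ?_
      exact hL V (mem_filter.1 hV).1 W (mem_filter.1 hV).2 (by omega)
    have h2 : ∑ V ∈ C, #{x | x ∈ V ∧ IsFresh F g W x} =
        ∑ x : E, #{V ∈ C | x ∈ V ∧ IsFresh F g W x} :=
      sum_card_bipartiteAbove_eq_sum_card_bipartiteBelow
        (fun V x => x ∈ V ∧ IsFresh F g W x)
    have h3 : ∀ x : E, #{V ∈ C | x ∈ V ∧ IsFresh F g W x} * L ^ t ≤
        Fintype.card E ^ (k - finrank F W - (t + 1) - 1) := by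
      intro x
      by_cases hx : IsFresh F g W x
      · set W' := W ⊔ Submodule.span F {x} ⊔ Submodule.span F {g x}
        have hW' : finrank F W' = finrank F W + 2 := by
          rw [Submodule.finrank_sup_span_singleton hx.2, Submodule.finrank_sup_span_singleton hx.1]
        have := ih W' (by omega)
        rw [hW', show k - (finrank F W + 2) - t = k - finrank F W - (t + 1) - 1 by omega] at this
        refine (Nat.mul_le_mul_right _ (card_le_card fun V hV => ?_)).trans this
        simp only [C, mem_filter] at hV ⊢
        refine ⟨hV.1.1, sup_le (sup_le hV.1.2 ?_) ?_⟩ <;> rw [Submodule.span_singleton_le_iff_mem]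
        exacts [hV.2.1, hg V hV.1.1 x hV.2.1]
      · simp [hx]
    calc #C * L ^ (t + 1) = #C * L * L ^ t := by ring
      _ ≤ (∑ x : E, #{V ∈ C | x ∈ V ∧ IsFresh F g W x}) * L ^ t :=
          Nat.mul_le_mul_right _ (h1.trans h2.le)
      _ ≤ ∑ _x : E, Fintype.card E ^ (k - finrank F W - (t + 1) - 1) := by
          rw [sum_mul]; exact sum_le_sum fun x _ => h3 x
      _ = Fintype.card E ^ (k - finrank F W - (t + 1)) := by
          rw [sum_const, smul_eq_mul, card_univ, ← pow_succ']
          congr 1; omega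

end Generation

section Generation

variable {F E : Type*} [Field F] [Fintype F] [AddCommGroup E] [Module F E] [Fintype E]

open Module Finset

open Classical in
lemma card_filter_mem {q : ℕ} (hF : Fintype.card F = q) (V : Submodule F E) :
    #{x | x ∈ V} = q ^ finrank F V := by
  rw [← hF, ← Module.card_eq_pow_finrank (K := F) (V := V), Fintype.card_subtype]

omit [Fintype F] [Fintype E] in
lemma eq_zero_of_smul_add_smul_mem {W : Submodule F E} {x y : E} (hx : x ∉ W)
    (hy : y ∉ W ⊔ Submodule.span F {x}) {a b : F} (h : a • x + b • y ∈ W) : a = 0 ∧ b = 0 := by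
  have hb : b = 0 := by
    by_contra hb
    apply hy
    have h1 : y = b⁻¹ • (a • x + b • y) + (-(b⁻¹ * a)) • x := by
      rw [smul_add, smul_smul, smul_smul, inv_mul_cancel₀ hb, neg_smul, one_smul]; abel
    rw [h1]
    exact Submodule.add_mem_sup (W.smul_mem _ h)
      (Submodule.smul_mem _ _ (Submodule.mem_span_singleton_self x))
  refine ⟨?_, hb⟩
  by_contra ha
  apply hx
  rw [hb, zero_smul, add_zero] at h
  simpa [smul_smul, inv_mul_cancel₀ ha] using W.smul_mem a⁻¹ h

omit [Fintype F] [Fintype E] in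
lemma exists_isFresh_of_semilinear {σ : F →+* F} {lam : F} (hlam : σ lam ≠ lam)
    (g : E →ₛₗ[σ] E) {W : Submodule F E} {x y : E} (hx : x ∉ W) (hgx : g x ∉ W)
    (hy : y ∉ W ⊔ Submodule.span F {x}) :
    IsFresh F g W x ∨ IsFresh F g W y ∨ IsFresh F g W (x + y) ∨ IsFresh F g W (x + lam • y) := by
  have hindep := fun {a b : F} => eq_zero_of_smul_add_smul_mem (a := a) (b := b) hx hy
  have hcomb : ∀ a b : F, (a ≠ 0 ∨ b ≠ 0) → ¬ IsFresh F g W (a • x + b • y) →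
      ∃ c : F, g (a • x + b • y) - c • (a • x + b • y) ∈ W := by
    intro a b hab hf
    have h1 : a • x + b • y ∉ W := fun h => by
      obtain ⟨h1, h2⟩ := hindep h
      simp [h1, h2] at hab
    simp only [IsFresh, h1, not_false_eq_true, true_and, not_not] at hf
    obtain ⟨w, hw, z, hz, hwz⟩ := Submodule.mem_sup.1 hf
    obtain ⟨c, rfl⟩ := Submodule.mem_span_singleton.1 hz
    exact ⟨c, by rw [← hwz]; simpa using hw⟩
  by_contra! hcon
  obtain ⟨h1, h2, h3, h4⟩ := hcon
  obtain ⟨α, hα⟩ := hcomb 1 0 (by simp) (by simpa using h1)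
  obtain ⟨β, hβ⟩ := hcomb 0 1 (by simp) (by simpa using h2)
  obtain ⟨γ, hγ⟩ := hcomb 1 1 (by simp) (by simpa using h3)
  obtain ⟨δ, hδ⟩ := hcomb 1 lam (by simp) (by simpa using h4)
  simp only [one_smul, zero_smul, add_zero, zero_add, map_add, map_smulₛₗ] at hα hβ hγ hδ
  have e1 : (α - γ) • x + (β - γ) • y ∈ W := by
    have := W.sub_mem hγ (W.add_mem hα hβ)
    convert this using 1
    module
  have e2 : (α - δ) • x + (σ lam * β - δ * lam) • y ∈ W := by
    have := W.sub_mem hδ (W.add_mem hα (W.smul_mem (σ lam) hβ))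
    convert this using 1
    module
  obtain ⟨a1, a2⟩ := hindep e1
  obtain ⟨b1, b2⟩ := hindep e2
  have hα0 : α * (σ lam - lam) = 0 := by linear_combination b2 + σ lam * (a1 - a2) - lam * b1
  have : α = 0 := (mul_eq_zero.1 hα0).resolve_right (sub_ne_zero.2 hlam)
  subst this
  simp only [zero_smul, sub_zero] at hα
  exact hgx hα

open Classical in
lemma le_card_isFresh_of_semilinear {q : ℕ} (hF : Fintype.card F = q) {σ : F →+* F}
    (hσ : σ ≠ RingHom.id F) (g : E →ₛₗ[σ] E) (hg : Function.Injective g) {V W : Submodule F E}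
    (hW : finrank F W + 2 ≤ finrank F V) :
    q ^ (finrank F V - 4) ≤ #{x | x ∈ V ∧ IsFresh F g W x} := by
  have hq : 2 ≤ q := hF ▸ Fintype.one_lt_card
  obtain ⟨lam, hlam⟩ : ∃ lam, σ lam ≠ lam := by
    by_contra! h
    exact hσ (RingHom.ext h)
  set G := (univ : Finset E).filter fun x => x ∈ V ∧ IsFresh F g W x
  set VF := (univ : Finset E).filter fun x => x ∈ V
  have hVF : #VF = q ^ finrank F V := card_filter_mem hF V
  set A := VF.filter fun x => x ∉ W ∧ g x ∉ W
  have hA : q ^ finrank F V ≤ #A + 2 * q ^ finrank F W := by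
    have h1 : VF ⊆ A ∪ ((univ : Finset E).filter (· ∈ W) ∪
        (univ : Finset E).filter (g · ∈ W)) := by
      intro x hx
      simp only [A, mem_union, mem_filter, mem_univ, true_and, hx]
      tauto
    have h2 : #((univ : Finset E).filter (g · ∈ W)) ≤ #((univ : Finset E).filter (· ∈ W)) :=
      card_le_card_of_injOn g (fun x hx => by simpa using hx) hg.injOn
    have h3 := (card_le_card h1).trans (card_union_le _ _)
    have h4 := card_union_le ((univ : Finset E).filter (· ∈ W)) ((univ : Finset E).filter (g · ∈ W))
    rw [card_filter_mem hF W] at h2 h4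
    omega
  let B : E → Finset E := fun x => VF.filter (· ∉ W ⊔ Submodule.span F {x})
  have hB : ∀ x ∈ A, q ^ finrank F V ≤ #(B x) + q ^ (finrank F W + 1) := by
    intro x hx
    have hxW : x ∉ W := (mem_filter.1 hx).2.1
    have h1 : VF ⊆ B x ∪ (univ : Finset E).filter (· ∈ W ⊔ Submodule.span F {x}) := by
      intro y hy
      simp only [B, mem_union, mem_filter, mem_univ, true_and, hy]
      tauto
    have h2 := (card_le_card h1).trans (card_union_le _ _)
    rwa [hVF, card_filter_mem hF, Submodule.finrank_sup_span_singleton hxW] at h2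
  have hpairs : #(A.sigma B) ≤ 4 * (#G * q ^ finrank F V) := by
    have hsub : ∀ f : E → E → E × E, (∀ x y x' y', f x y = f x' y' → x = x' ∧ y = y') →
        (∀ x ∈ V, ∀ y ∈ V, (f x y).1 ∈ V ∧ (f x y).2 ∈ V) →
        #((A.sigma B).filter fun p => IsFresh F g W (f p.1 p.2).1) ≤ #G * q ^ finrank F V := by
      intro f hf hfV
      rw [← hVF, ← card_product]
      refine card_le_card_of_injOn (fun p => f p.1 p.2) ?_ ?_
      · rintro ⟨x, y⟩ hp
        simp only [A, B, VF, G, coe_filter, mem_sigma, mem_filter, mem_univ, true_and,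
          Set.mem_ofPred_eq, coe_product, Set.mem_prod] at hp ⊢
        have := hfV x hp.1.1.1 y hp.1.2.1
        exact ⟨⟨this.1, hp.2⟩, this.2⟩
      · rintro ⟨x, y⟩ - ⟨x', y'⟩ - h
        obtain ⟨rfl, rfl⟩ := hf _ _ _ _ h
        rfl
    have s1 := hsub (fun x y => (x, y)) (by simp) (by simp +contextual)
    have s2 := hsub (fun x y => (y, x)) (by simp +contextual) (by simp +contextual)
    have s3 := hsub (fun x y => (x + y, y)) (fun x y x' y' h => by
      obtain ⟨h1, rfl⟩ := Prod.mk.inj h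
      exact ⟨add_right_cancel h1, rfl⟩)
      (by simp +contextual [V.add_mem])
    have s4 := hsub (fun x y => (x + lam • y, y)) (fun x y x' y' h => by
      obtain ⟨h1, rfl⟩ := Prod.mk.inj h
      exact ⟨add_right_cancel h1, rfl⟩)
      (by simp +contextual [V.add_mem, V.smul_mem])
    have hcover : A.sigma B ⊆
        ((A.sigma B).filter fun p => IsFresh F g W p.1) ∪
        (((A.sigma B).filter fun p => IsFresh F g W p.2) ∪
        (((A.sigma B).filter fun p => IsFresh F g W (p.1 + p.2)) ∪
        ((A.sigma B).filter fun p => IsFresh F g W (p.1 + lam • p.2)))) := by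
      rintro ⟨x, y⟩ hp
      simp only [mem_union, mem_filter, hp, true_and]
      simp only [A, B, mem_sigma, mem_filter] at hp
      exact exists_isFresh_of_semilinear hlam g hp.1.2.1 hp.1.2.2 hp.2.2
    refine (card_le_card hcover).trans ((card_union_le _ _).trans ?_)
    refine (Nat.add_le_add_left ((card_union_le _ _).trans
      (Nat.add_le_add_left (card_union_le _ _) _)) _).trans ?_
    simp only at s1 s2 s3 s4
    omega
  obtain ⟨e, he⟩ : ∃ e, finrank F V = finrank F W + 2 + e := ⟨_, (Nat.add_sub_of_le hW).symm⟩
  have hW1 : 2 * (2 * q ^ finrank F W) ≤ q ^ finrank F V := by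
    calc 2 * (2 * q ^ finrank F W) ≤ q * (q * q ^ finrank F W) := by gcongr
      _ = q ^ (finrank F W + 2) := by ring
      _ ≤ _ := Nat.pow_le_pow_right (by omega) hW
  have hW2 : 2 * q ^ (finrank F W + 1) ≤ q ^ finrank F V := by
    calc 2 * q ^ (finrank F W + 1) ≤ q * q ^ (finrank F W + 1) := by gcongr
      _ = q ^ (finrank F W + 2) := by ring
      _ ≤ _ := Nat.pow_le_pow_right (by omega) hW
  have hlow : #A * q ^ finrank F V ≤ 2 * #(A.sigma B) := by
    rw [card_sigma, mul_sum, ← smul_eq_mul]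
    refine card_nsmul_le_sum _ _ _ fun x hx => ?_
    have := hB x hx
    omega
  have hpos : 0 < q ^ finrank F V := by positivity
  have hA8 : #A ≤ 8 * #G := by
    refine Nat.le_of_mul_le_mul_right (c := q ^ finrank F V) ?_ hpos
    calc _ ≤ 2 * #(A.sigma B) := hlow
      _ ≤ 2 * (4 * (#G * q ^ finrank F V)) := by gcongr
      _ = _ := by ring
  have hfin : q ^ finrank F V ≤ 16 * #G := by omega
  rcases le_or_gt 4 (finrank F V) with h4 | h4
  · have : 16 * q ^ (finrank F V - 4) ≤ q ^ finrank F V := by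
      calc 16 * q ^ (finrank F V - 4) ≤ q ^ 4 * q ^ (finrank F V - 4) := by
            gcongr
            calc 16 = 2 ^ 4 := by norm_num
              _ ≤ q ^ 4 := by gcongr
        _ = _ := by rw [← pow_add]; congr 1; omega
    omega
  · rw [Nat.sub_eq_zero_of_le h4.le, pow_zero]
    omega

open Classical in
lemma le_card_isFresh_of_linear {q : ℕ} (hF : Fintype.card F = q) (g : E →ₗ[F] E) {κ : ℕ}
    (hg : ∀ c : F, finrank F (LinearMap.ker (g - c • LinearMap.id)) ≤ κ) {V W : Submodule F E}
    (hW : finrank F W + κ + 3 ≤ finrank F V) :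
    q ^ (finrank F V - 4) ≤ #{x | x ∈ V ∧ IsFresh F g W x} := by
  have hq : 2 ≤ q := hF ▸ Fintype.one_lt_card
  have hcov : (univ : Finset E).filter (· ∈ V) ⊆
      (univ : Finset E).filter (fun x => x ∈ V ∧ IsFresh F g W x) ∪
      ((univ : Finset E).filter (· ∈ W) ∪ (univ : Finset F).biUnion fun c =>
        (univ : Finset E).filter (· ∈ W.comap (g - c • LinearMap.id))) := by
    intro x hx
    by_cases hxW : x ∈ W
    · simp [hxW]
    by_cases hf : IsFresh F g W x
    · simp [hf, (mem_filter.1 hx).2]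
    simp only [IsFresh, hxW, not_false_eq_true, true_and, not_not] at hf
    obtain ⟨w, hw, z, hz, hwz⟩ := Submodule.mem_sup.1 hf
    obtain ⟨c, rfl⟩ := Submodule.mem_span_singleton.1 hz
    simp only [mem_union, mem_biUnion, mem_filter, mem_univ, true_and, Submodule.mem_comap,
      LinearMap.sub_apply, LinearMap.smul_apply, LinearMap.id_apply]
    exact Or.inr (Or.inr ⟨c, by rw [← hwz]; simpa using hw⟩)
  have h1 : #((univ : Finset F).biUnion fun c =>
        (univ : Finset E).filter (· ∈ W.comap (g - c • LinearMap.id))) ≤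
        q * q ^ (finrank F W + κ) := by
    refine (card_biUnion_le_card_mul _ _ (q ^ (finrank F W + κ)) fun c _ => ?_).trans
      (by rw [card_univ, hF])
    rw [card_filter_mem hF]
    exact Nat.pow_le_pow_right (by omega) ((finrank_comap_le _ _).trans (by have := hg c; omega))
  have h2 := (card_le_card hcov).trans ((card_union_le _ _).trans
    (Nat.add_le_add_left (card_union_le _ _) _))
  rw [card_filter_mem hF, card_filter_mem hF] at h2
  have h3 : q ^ finrank F W ≤ q ^ (finrank F W + κ) := Nat.pow_le_pow_right (by omega) (by omega)
  have h4 : 4 * q ^ (finrank F W + κ + 1) ≤ q ^ finrank F V := by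
    calc 4 * q ^ (finrank F W + κ + 1) ≤ q ^ 2 * q ^ (finrank F W + κ + 1) := by
          gcongr; nlinarith
      _ = q ^ (finrank F W + κ + 3) := by rw [← pow_add]; congr 1; omega
      _ ≤ _ := Nat.pow_le_pow_right (by omega) hW
  have h5 : q * q ^ (finrank F W + κ) = q ^ (finrank F W + κ + 1) := by ring
  have h6 : q ^ (finrank F W + κ) ≤ q ^ (finrank F W + κ + 1) :=
    Nat.pow_le_pow_right (by omega) (by omega)
  have h7 : 2 * q ^ (finrank F V - 4) ≤ q ^ finrank F V := by
    calc 2 * q ^ (finrank F V - 4) ≤ q * q ^ (finrank F V - 4) := by gcongr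
      _ = q ^ (finrank F V - 4 + 1) := by ring
      _ ≤ _ := Nat.pow_le_pow_right (by omega) (by omega)
  omega

lemma card_le_of_isFresh {q : ℕ} (hF : Fintype.card F = q) (g : E → E)
    (S : Finset (Submodule F E)) {k κ : ℕ} (hS : ∀ V ∈ S, finrank F V = k)
    (hg : ∀ V ∈ S, ∀ x ∈ V, g x ∈ V)
    (hL : ∀ V ∈ S, ∀ W ≤ V, finrank F W + 2 + κ ≤ k →
      q ^ (k - 4) ≤ Nat.card {x // x ∈ V ∧ IsFresh F g W x}) :
    (#S : ℝ) ≤ (q : ℝ) ^ ((finrank F E : ℝ) ^ 2 / 8 + (κ + 3) * finrank F E) := by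
  classical
  have hq : 2 ≤ q := hF ▸ Fintype.one_lt_card
  have hq1 : (1 : ℝ) ≤ q := by exact_mod_cast (by omega : 1 ≤ q)
  set d := finrank F E
  have hE : Fintype.card E = q ^ d := by rw [← hF]; exact Module.card_eq_pow_finrank
  rcases S.eq_empty_or_nonempty with rfl | ⟨V₀, hV₀⟩
  · simp; positivity
  have hkd : k ≤ d := hS V₀ hV₀ ▸ V₀.finrank_le
  have hkd' : (k : ℝ) ≤ d := by exact_mod_cast hkd
  have hbot : #{V ∈ S | ⊥ ≤ V} = #S := by simp
  by_cases hk : k ≤ κ + 3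
  · have h1 := card_filter_le_pow S hS k ⊥ (by simp)
    rw [hbot, hE, ← pow_mul] at h1
    calc (#S : ℝ) ≤ (q : ℝ) ^ (d * k) := by exact_mod_cast h1
      _ = (q : ℝ) ^ ((d * k : ℕ) : ℝ) := by rw [Real.rpow_natCast]
      _ ≤ _ := by
        apply Real.rpow_le_rpow_of_exponent_le hq1
        have : (k : ℝ) ≤ κ + 3 := by exact_mod_cast hk
        push_cast
        nlinarith [sq_nonneg (d : ℝ)]
  · push Not at hk
    set t := (k - κ) / 2
    have h1 := card_filter_mul_pow_le (L := q ^ (k - 4)) (κ := κ) g S hS hg (by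
      intro V hV W hWV hW
      have := hL V hV W hWV hW
      rwa [Nat.card_eq_fintype_card, Fintype.card_subtype] at this) t ⊥ (by
        simp only [finrank_bot]; omega)
    rw [hbot, hE, ← pow_mul, ← pow_mul, finrank_bot, Nat.sub_zero] at h1
    have h2 : (#S : ℝ) * (q : ℝ) ^ (((k - 4) * t : ℕ) : ℝ) ≤ (q : ℝ) ^ ((d * (k - t) : ℕ) : ℝ) := by
      rw [Real.rpow_natCast, Real.rpow_natCast]
      exact_mod_cast h1
    rw [← le_div_iff₀ (by positivity), ← Real.rpow_sub (by positivity)] at h2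
    refine h2.trans (Real.rpow_le_rpow_of_exponent_le hq1 ?_)
    have ht : (k : ℝ) - κ - 1 ≤ 2 * t := by
      have : k ≤ 2 * t + κ + 1 := by omega
      have : (k : ℝ) ≤ 2 * t + κ + 1 := by exact_mod_cast this
      linarith
    rw [Nat.cast_mul, Nat.cast_mul, Nat.cast_sub (by omega), Nat.cast_sub (by omega)]
    push_cast
    have hk4 : (4 : ℝ) ≤ k := by exact_mod_cast (by omega : 4 ≤ k)
    have hκ : (0 : ℝ) ≤ κ := by positivity
    nlinarith [mul_le_mul_of_nonneg_right ht (by linarith : (0 : ℝ) ≤ (d : ℝ) + k - 4),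
      sq_nonneg ((d : ℝ) - 2 * k), mul_le_mul_of_nonneg_left hkd' hκ]

end Generation

section Semimonomial

open Module

variable (F : Type) [Field F] (n : ℕ)

/-- Field automorphisms and coordinate permutations acting on diagonal matrices. -/
def twist : (F ≃+* F) × Equiv.Perm (Fin n) →* MulAut (Fin n → Fˣ) where
  toFun s :=
    { toFun := fun d i => Units.map (s.1 : F →* F) (d (s.2⁻¹ i))
      invFun := fun d i => Units.map (s.1⁻¹ : F ≃+* F).toMonoidHom (d (s.2 i))
      left_inv := fun d => by
        ext i; simp [RingAut.inv_apply]
      right_inv := fun d => by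
        ext i; simp [RingAut.inv_apply]
      map_mul' := fun d e => by ext i; simp }
  map_one' := by ext d i; simp
  map_mul' s t := by ext d i; simp [_root_.mul_inv_rev]

/-- The semilinear monomial group, as an abstract group. -/
abbrev SemiMon : Type := (Fin n → Fˣ) ⋊[twist F n] ((F ≃+* F) × Equiv.Perm (Fin n))

variable {F n}

lemma twist_apply (s : (F ≃+* F) × Equiv.Perm (Fin n)) (d : Fin n → Fˣ) (i : Fin n) :
    ((twist F n s d i : Fˣ) : F) = s.1 (d (s.2⁻¹ i)) := rfl

/-- The semilinear map of `F ^ n` defined by an element of the semilinear monomial group. -/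
def semimap (g : SemiMon F n) :
    (Fin n → F) →ₛₗ[(g.right.1 : F →+* F)] (Fin n → F) where
  toFun x i := g.left i * g.right.1 (x (g.right.2⁻¹ i))
  map_add' x y := by ext i; simp [mul_add]
  map_smul' c x := by ext i; simp [mul_left_comm]

lemma semimap_apply (g : SemiMon F n) (x : Fin n → F) (i : Fin n) :
    semimap g x i = g.left i * g.right.1 (x (g.right.2⁻¹ i)) := rfl

lemma semimap_one (x : Fin n → F) : semimap (1 : SemiMon F n) x = x := by
  ext i; rw [semimap_apply]; simp

lemma semimap_mul (g g' : SemiMon F n) (x : Fin n → F) :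
    semimap (g * g') x = semimap g (semimap g' x) := by
  ext i
  rw [semimap_apply, semimap_apply, semimap_apply]
  simp [twist_apply, mul_assoc]

lemma semimap_inv_semimap (g : SemiMon F n) (x : Fin n → F) :
    semimap g⁻¹ (semimap g x) = x := by
  rw [← semimap_mul, inv_mul_cancel, semimap_one]

lemma semimap_semimap_inv (g : SemiMon F n) (x : Fin n → F) :
    semimap g (semimap g⁻¹ x) = x := by
  rw [← semimap_mul, mul_inv_cancel, semimap_one]

lemma semimap_injective (g : SemiMon F n) : Function.Injective (semimap g) :=
  Function.LeftInverse.injective (semimap_inv_semimap g)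

lemma finrank_comap_semimap [Finite F] (g : SemiMon F n) (V : Submodule F (Fin n → F)) :
    finrank F (V.comap (semimap g)) = finrank F V := by
  have e : V.comap (semimap g) ≃ V :=
    { toFun := fun x => ⟨semimap g x, x.2⟩
      invFun := fun x => ⟨semimap g⁻¹ x, by
        rw [Submodule.mem_comap, semimap_semimap_inv]; exact x.2⟩
      left_inv := fun x => Subtype.ext (semimap_inv_semimap g x)
      right_inv := fun x => Subtype.ext (semimap_semimap_inv g x) }
  have h := Nat.card_congr e
  rw [Module.natCard_eq_pow_finrank (K := F) (V := V),
    Module.natCard_eq_pow_finrank (K := F) (V := V.comap (semimap g))] at h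
  exact Nat.pow_right_injective (Finite.one_lt_card (α := F)) h

instance semiMonAction [Finite F] (k : ℕ) :
    MulAction (SemiMon F n) {V : Submodule F (Fin n → F) // finrank F V = k} where
  smul g V := ⟨V.1.comap (semimap g⁻¹), (finrank_comap_semimap _ _).trans V.2⟩
  one_smul V := Subtype.ext <| Submodule.ext fun x => by
    change semimap (1 : SemiMon F n)⁻¹ x ∈ V.1 ↔ _
    rw [inv_one, semimap_one]
  mul_smul g g' V := Subtype.ext <| Submodule.ext fun x => by
    change semimap (g * g')⁻¹ x ∈ V.1 ↔ semimap g'⁻¹ (semimap g⁻¹ x) ∈ V.1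
    rw [_root_.mul_inv_rev, semimap_mul]

lemma mem_smul_iff [Finite F] {k : ℕ} (g : SemiMon F n)
    (V : {V : Submodule F (Fin n → F) // finrank F V = k}) (x : Fin n → F) :
    x ∈ (g • V).1 ↔ semimap g⁻¹ x ∈ V.1 := Iff.rfl

lemma exists_mulVec_of_mem_monomialGroup {M : GL (Fin n) F} (hM : M ∈ MonomialGroup F n) :
    ∃ (d : Fin n → Fˣ) (π : Equiv.Perm (Fin n)),
      ∀ x i, mulVec (M : Matrix (Fin n) (Fin n) F) x i = d i * x (π⁻¹ i) := by
  induction hM using Subgroup.closure_induction with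
  | mem M hM =>
    rcases hM with ⟨σ, hσ⟩ | ⟨d, hd⟩
    · refine ⟨1, σ⁻¹, fun x i => ?_⟩
      rw [hσ, Matrix.permMatrix_mulVec]
      simp
    · have hdet : IsUnit (∏ i, d i) := by
        rw [← Matrix.det_diagonal, ← hd]
        exact (Matrix.isUnit_iff_isUnit_det _).1 M.isUnit
      have h0 : ∀ i, IsUnit (d i) := by
        intro i
        rw [isUnit_iff_ne_zero] at hdet ⊢
        exact Finset.prod_ne_zero_iff.1 hdet i (Finset.mem_univ i)
      refine ⟨fun i => (h0 i).unit, 1, fun x i => ?_⟩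
      rw [hd, Matrix.mulVec_diagonal]
      simp
  | one => exact ⟨1, 1, fun x i => by simp⟩
  | mul M M' _ _ ih ih' =>
    obtain ⟨d, π, h⟩ := ih
    obtain ⟨d', π', h'⟩ := ih'
    refine ⟨fun i => d i * d' (π⁻¹ i), π * π', fun x i => ?_⟩
    rw [Units.val_mul, ← Matrix.mulVec_mulVec, h, h', _root_.mul_inv_rev]
    simp [mul_assoc]
  | inv M _ ih =>
    obtain ⟨d, π, h⟩ := ih
    refine ⟨fun i => (d (π i))⁻¹, π⁻¹, fun x i => ?_⟩
    have h1 := h (mulVec ((M⁻¹ : GL (Fin n) F) : Matrix (Fin n) (Fin n) F) x) (π i)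
    rw [Matrix.mulVec_mulVec, ← Units.val_mul, mul_inv_cancel, Units.val_one, Matrix.one_mulVec,
      Equiv.Perm.inv_def, Equiv.symm_apply_apply] at h1
    rw [inv_inv, h1, ← mul_assoc]
    simp

lemma exists_monomialGroup_mulVec (d : Fin n → Fˣ) (π : Equiv.Perm (Fin n)) :
    ∃ M ∈ MonomialGroup F n,
      ∀ x i, mulVec (M : Matrix (Fin n) (Fin n) F) x i = d i * x (π⁻¹ i) := by
  let D : GL (Fin n) F :=
    ⟨diagonal fun i => (d i : F), diagonal fun i => ((d i)⁻¹ : Fˣ), by simp, by simp⟩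
  let P : GL (Fin n) F :=
    ⟨π⁻¹.permMatrix F, π.permMatrix F, by simp [← Matrix.permMatrix_mul],
      by simp [← Matrix.permMatrix_mul]⟩
  refine ⟨D * P, mul_mem (Subgroup.subset_closure (Or.inr ⟨_, rfl⟩))
    (Subgroup.subset_closure (Or.inl ⟨_, rfl⟩)), fun x i => ?_⟩
  rw [Units.val_mul, ← Matrix.mulVec_mulVec]
  simp [D, P, Matrix.mulVec_diagonal, Matrix.permMatrix_mulVec]

lemma semiRel_iff [Finite F] {k : ℕ} (V W : {V : Submodule F (Fin n → F) // finrank F V = k}) :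
    semiRel F n V.1 W.1 ↔ ∃ g : SemiMon F n, g • V = W := by
  have key : ∀ (g : SemiMon F n), (W.1 : Set (Fin n → F)) = semimap g '' (V.1 : Set (Fin n → F)) ↔
      g • V = W := by
    intro g
    have : ((g • V).1 : Set (Fin n → F)) = semimap g '' (V.1 : Set (Fin n → F)) := by
      ext x
      constructor
      · exact fun hx => ⟨semimap g⁻¹ x, hx, semimap_semimap_inv g x⟩
      · rintro ⟨y, hy, rfl⟩
        rw [SetLike.mem_coe, mem_smul_iff, semimap_inv_semimap]
        exact hy
    rw [← this, SetLike.coe_set_eq, Subtype.coe_inj, eq_comm]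
  constructor
  · rintro ⟨σ, M, hM, h⟩
    obtain ⟨d, π, hdπ⟩ := exists_mulVec_of_mem_monomialGroup hM
    refine ⟨⟨d, (σ, π)⟩, (key _).1 (h.trans ?_)⟩
    congr 1
    ext x i
    rw [hdπ]; rfl
  · rintro ⟨g, hg⟩
    obtain ⟨M, hM, h⟩ := exists_monomialGroup_mulVec g.left g.right.2
    refine ⟨g.right.1, M, hM, ((key g).2 hg).trans ?_⟩
    congr 1
    ext x i
    rw [h]; rfl

lemma numClassesDimSemi_eq_card_orbits [Finite F] (k : ℕ) :
    numClassesDimSemi F n k = Nat.card (MulAction.orbitRel.Quotient (SemiMon F n)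
      {V : Submodule F (Fin n → F) // finrank F V = k}) := by
  refine Nat.card_congr (Quot.congrRight fun V W => ?_)
  rw [semiRel_iff]
  change _ ↔ V ∈ MulAction.orbit (SemiMon F n) W
  rw [← MulAction.mem_orbit_symm]
  rfl

end Semimonomial

section SemimonomialCard

open Module

variable {F : Type} [Field F] {n : ℕ}

instance [Finite F] : Finite (F ≃+* F) :=
  Finite.of_injective (fun f : F ≃+* F => (f : F → F)) DFunLike.coe_injective

lemma card_ringAut [Fintype F] {p h : ℕ} (hp : p.Prime) (hF : Fintype.card F = p ^ h) :
    Nat.card (F ≃+* F) = h := by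
  have : Fact p.Prime := ⟨hp⟩
  have : CharP F p := charP_of_card_eq_prime_pow hF
  let _ : Algebra (ZMod p) F := ZMod.algebra F p
  have e : (F ≃+* F) ≃ (F ≃ₐ[ZMod p] F) :=
    { toFun := fun f => AlgEquiv.ofRingEquiv (f := f) fun x =>
        RingHom.congr_fun (Subsingleton.elim ((f : F →+* F).comp (algebraMap (ZMod p) F))
          (algebraMap (ZMod p) F)) x
      invFun := fun f => f
      left_inv := fun f => by ext; rfl
      right_inv := fun f => by ext; rfl }
  rw [Nat.card_congr e, IsGalois.card_aut_eq_finrank]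
  have h1 := Module.card_eq_pow_finrank (K := ZMod p) (V := F)
  rw [hF, ZMod.card] at h1
  exact (Nat.pow_right_injective hp.two_le h1).symm

lemma card_semiMon [Fintype F] {q h : ℕ} (hF : Fintype.card F = q)
    (hh : Nat.card (F ≃+* F) = h) :
    Nat.card (SemiMon F n) = (q - 1) ^ n * (h * n.factorial) := by
  classical
  rw [SemidirectProduct.card, Nat.card_prod, hh, Nat.card_pi, Finset.prod_const,
    Nat.card_eq_fintype_card, Fintype.card_units, hF, Finset.card_univ, Fintype.card_fin,
    Nat.card_perm, Nat.card_fin]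

instance [Finite F] : Finite (SemiMon F n) :=
  Finite.of_equiv _ SemidirectProduct.equivProd.symm

open Classical in
/-- The coordinates at which a semilinear monomial map differs from the scalar `c`. -/
noncomputable def moved (g : SemiMon F n) (c : Fˣ) : Finset (Fin n) :=
  {i | ¬(g.right.2 i = i ∧ g.left i = c)}

lemma mem_moved {g : SemiMon F n} {c : Fˣ} {i : Fin n} :
    i ∈ moved g c ↔ ¬(g.right.2 i = i ∧ g.left i = c) := by
  simp [moved]

lemma exists_subset_range_of_card_le {α : Type*} [Nonempty α] {s : Finset α} {m : ℕ}
    (hs : s.card ≤ m) : ∃ e : Fin m → α, (s : Set α) ⊆ Set.range e := by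
  classical
  obtain ⟨a⟩ := ‹Nonempty α›
  refine ⟨fun i => if hi : (i : ℕ) < s.card then s.equivFin.symm ⟨i, hi⟩ else a, fun x hx => ?_⟩
  refine ⟨⟨s.equivFin ⟨x, hx⟩, (s.equivFin ⟨x, hx⟩).2.trans_le hs⟩, ?_⟩
  simp

lemma card_moved_le [Fintype F] {q h : ℕ} (hF : Fintype.card F = q)
    (hh : Nat.card (F ≃+* F) = h) (hn : 0 < n) (m : ℕ) :
    Nat.card {g : SemiMon F n // ∃ c, (moved g c).card ≤ m} ≤ q * h * (n ^ 2 * q) ^ m := by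
  classical
  have : Nonempty (Fin n) := ⟨⟨0, hn⟩⟩
  have key : ∀ g : {g : SemiMon F n // ∃ c, (moved g c).card ≤ m},
      ∃ (c : Fˣ) (e : Fin m → Fin n), (moved g.1 c : Set (Fin n)) ⊆ Set.range e := by
    rintro ⟨g, c, hc⟩
    exact ⟨c, exists_subset_range_of_card_le hc⟩
  choose c e he using key
  let f : {g : SemiMon F n // ∃ c, (moved g c).card ≤ m} →
      F × (F ≃+* F) × (Fin m → (Fin n × Fin n) × F) := fun g =>
    (c g, g.1.right.1, fun j => ((e g j, g.1.right.2 (e g j)), g.1.left (e g j)))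
  have hf : Function.Injective f := by
    intro g g' hgg
    simp only [f, Prod.mk.injEq, funext_iff, Units.val_inj] at hgg
    obtain ⟨hc, hσ, h⟩ := hgg
    have hee : e g = e g' := funext fun j => (h j).1.1
    have hall : ∀ i, g.1.right.2 i = g'.1.right.2 i ∧ g.1.left i = g'.1.left i := by
      intro i
      by_cases hi : i ∈ Set.range (e g)
      · obtain ⟨j, rfl⟩ := hi
        refine ⟨(h j).1.2.trans (by rw [hee]), (h j).2.trans (by rw [hee])⟩
      · have h1 := mt (@he g i) hi
        have h2 := mt (@he g' i) (hee ▸ hi)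
        rw [Finset.mem_coe, mem_moved, not_not] at h1 h2
        exact ⟨h1.1.trans h2.1.symm, h1.2.trans (hc.trans h2.2.symm)⟩
    exact Subtype.ext (SemidirectProduct.ext (funext fun i => (hall i).2)
      (Prod.ext hσ (Equiv.ext fun i => (hall i).1)))
  calc _ ≤ Nat.card (F × (F ≃+* F) × (Fin m → (Fin n × Fin n) × F)) :=
        Nat.card_le_card_of_injective f hf
    _ = _ := by
      simp only [Nat.card_prod, Nat.card_fun, Nat.card_fin, hh]
      rw [Nat.card_eq_fintype_card, hF]
      ring

/-- The number of subspaces of dimension `k` fixed by a semilinear monomial map. -/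
noncomputable def fixCount (k : ℕ) (g : SemiMon F n) : ℕ :=
  Nat.card {V : Submodule F (Fin n → F) //
    finrank F V = k ∧ ∀ x, x ∈ V ↔ semimap g⁻¹ x ∈ V}

lemma numClassesDimSemi_mul_card [Finite F] [Fintype (SemiMon F n)] (k : ℕ) :
    numClassesDimSemi F n k * Nat.card (SemiMon F n) = ∑ g : SemiMon F n, fixCount k g := by
  classical
  have := Fintype.ofFinite F
  have : Fintype {V : Submodule F (Fin n → F) // finrank F V = k} := Fintype.ofFinite _
  rw [numClassesDimSemi_eq_card_orbits, Nat.card_eq_fintype_card, Nat.card_eq_fintype_card,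
    ← MulAction.sum_card_fixedBy_eq_card_orbits_mul_card_group]
  refine Finset.sum_congr rfl fun g _ => ?_
  rw [fixCount, ← Nat.card_eq_fintype_card]
  refine Nat.card_congr
    { toFun := fun V => ⟨V.1.1, V.1.2, fun x => ?_⟩
      invFun := fun V => ⟨⟨V.1, V.2.1⟩, Subtype.ext <| Submodule.ext fun x => (V.2.2 x).symm⟩
      left_inv := fun V => rfl
      right_inv := fun V => rfl }
  rw [← mem_smul_iff, V.2]

lemma semimap_mem_of_fixed {g : SemiMon F n} {V : Submodule F (Fin n → F)}
    (hV : ∀ x, x ∈ V ↔ semimap g⁻¹ x ∈ V) {x : Fin n → F} (hx : x ∈ V) : semimap g x ∈ V := by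
  rw [hV, semimap_inv_semimap]; exact hx

/-- The elements of the semilinear monomial group acting as scalars. -/
def IsScalar (g : SemiMon F n) : Prop := g.right = 1 ∧ ∃ c, ∀ i, g.left i = c

lemma fixCount_of_isScalar {k : ℕ} {g : SemiMon F n} (hg : IsScalar g) :
    fixCount k g = Nat.card {V : Submodule F (Fin n → F) // finrank F V = k} := by
  obtain ⟨h1, c, hc⟩ := hg
  have hgc : ∀ x, semimap g x = (c : F) • x := fun x => by
    ext i
    rw [semimap_apply, h1, hc]
    simp
  refine Nat.card_congr (Equiv.subtypeEquivRight fun V => and_iff_left fun x => ?_)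
  rw [← Submodule.smul_mem_iff V c.ne_zero (x := semimap g⁻¹ x), ← hgc, semimap_semimap_inv]

lemma card_isScalar [Fintype F] {q : ℕ} (hF : Fintype.card F = q) (hn : 0 < n) :
    Nat.card {g : SemiMon F n // IsScalar g} = q - 1 := by
  classical
  rw [← hF, ← Fintype.card_units, ← Nat.card_eq_fintype_card]
  refine Nat.card_congr
    { toFun := fun g => g.1.left ⟨0, hn⟩
      invFun := fun c => ⟨⟨fun _ => c, 1⟩, rfl, c, fun _ => rfl⟩
      left_inv := ?_
      right_inv := fun c => rfl }
  rintro ⟨g, h1, c, hc⟩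
  refine Subtype.ext (SemidirectProduct.ext (funext fun i => ?_) h1.symm)
  exact (hc _).trans (hc i).symm

end SemimonomialCard

section FixedPoints

open Module

variable {F : Type} [Field F] {n : ℕ}

/-- The linear map of `F ^ n` defined by the monomial part of `g`. -/
def monomialMap (g : SemiMon F n) : (Fin n → F) →ₗ[F] (Fin n → F) where
  toFun x i := g.left i * x (g.right.2⁻¹ i)
  map_add' x y := by ext i; simp [mul_add]
  map_smul' c x := by ext i; simp [mul_left_comm]

lemma monomialMap_apply (g : SemiMon F n) (x : Fin n → F) (i : Fin n) :
    monomialMap g x i = g.left i * x (g.right.2⁻¹ i) := rfl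

lemma semimap_eq_monomialMap {g : SemiMon F n} (hg : g.right.1 = 1) (x : Fin n → F) :
    semimap g x = monomialMap g x := by
  ext i; rw [semimap_apply, hg]; rfl

lemma monomialMap_injective (g : SemiMon F n) : Function.Injective (monomialMap g) := by
  intro x y hxy
  ext i
  have h := congrFun hxy (g.right.2 i)
  simpa [monomialMap_apply] using h

lemma card_moved_le_two_mul_finrank (g : SemiMon F n) (c : Fˣ) :
    (moved g c).card ≤
      2 * finrank F (LinearMap.range (monomialMap g - (c : F) • LinearMap.id)) := by
  classical
  set N := monomialMap g - (c : F) • LinearMap.id with hN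
  have hNe : ∀ i j, N (Pi.single j 1) i =
      g.left i * (if g.right.2 j = i then 1 else 0) - c * (if j = i then 1 else 0) := by
    intro i j
    simp only [hN, LinearMap.sub_apply, LinearMap.smul_apply, LinearMap.id_apply, Pi.sub_apply,
      Pi.smul_apply, monomialMap_apply, smul_eq_mul, Pi.single_apply]
    congr 3
    · rw [Equiv.Perm.inv_eq_iff_eq]; exact propext eq_comm
    · exact propext eq_comm
  have hspan : Submodule.span F (Set.range fun j => N (Pi.single j 1)) = LinearMap.range N := by
    rw [LinearMap.range_eq_map, ← (Pi.basisFun F (Fin n)).span_eq, Submodule.map_span,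
      ← Set.range_comp]
    congr; ext; simp
  obtain ⟨f, hf, hfs, -⟩ := Submodule.exists_fun_fin_finrank_span_eq F
    (Set.range fun j => N (Pi.single j 1))
  replace hfs := hfs.trans hspan
  choose j hj using hf
  let U := Finset.univ.image j ∪ Finset.univ.image (g.right.2 ∘ j)
  have hU : U.card ≤ 2 * finrank F (LinearMap.range N) := by
    refine (Finset.card_union_le _ _).trans ?_
    have h1 := Finset.card_image_le (s := Finset.univ) (f := j)
    have h2 := Finset.card_image_le (s := Finset.univ) (f := g.right.2 ∘ j)
    rw [Finset.card_univ, Fintype.card_fin] at h1 h2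
    rw [← hspan]
    omega
  have hsupp : ∀ v ∈ LinearMap.range N, ∀ i ∉ U, v i = 0 := by
    intro v hv i hi
    rw [← hfs] at hv
    induction hv using Submodule.span_induction with
    | mem v hv =>
      obtain ⟨l, rfl⟩ := hv
      simp only [U, Finset.mem_union, Finset.mem_image, Finset.mem_univ, true_and, not_or,
        not_exists, Function.comp_apply] at hi
      rw [← hj l]
      beta_reduce
      rw [hNe, if_neg (hi.1 l), if_neg (hi.2 l)]
      simp
    | zero => rfl
    | add u v _ _ hu hv => simp [hu, hv]
    | smul a v _ hv => simp [hv]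
  refine (Finset.card_le_card fun i hi => ?_).trans hU
  by_contra hiU
  have h0 := hsupp (N (Pi.single i 1)) ⟨_, rfl⟩ i hiU
  rw [hNe] at h0
  rw [mem_moved] at hi
  refine hi ?_
  by_cases hπ : g.right.2 i = i
  · refine ⟨hπ, Units.ext ?_⟩
    simpa [hπ, sub_eq_zero] using h0
  · simp [hπ] at h0

lemma fixCount_le [Fintype F] (g : SemiMon F n) (k : ℕ) :
    fixCount k g ≤
      Nat.card {V : Submodule F (Fin n → F) // finrank F V = k ∧ ∀ x ∈ V, semimap g x ∈ V} :=
  Nat.card_le_card_of_injective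
    (fun V => ⟨V.1, V.2.1, fun _ hx => semimap_mem_of_fixed V.2.2 hx⟩)
    fun _ _ h => Subtype.ext (congrArg (fun V => V.1) h)

lemma fixCount_le_subspaceBound [Fintype F] {q : ℕ} (hF : Fintype.card F = q) {g : SemiMon F n}
    (hg : g.right.1 = 1) (c : F) (k : ℕ) :
    (fixCount k g : ℝ) ≤
      subspaceBound q (finrank F (LinearMap.range (monomialMap g - c • LinearMap.id))) *
      subspaceBound q (finrank F (LinearMap.ker (monomialMap g - c • LinearMap.id))) := by
  refine le_trans ?_ (card_invariant_le hF _)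
  refine Nat.cast_le.2 ((fixCount_le g k).trans ?_)
  refine Nat.card_le_card_of_injective (fun V => ⟨V.1, fun x hx => ?_⟩)
    fun _ _ h => Subtype.ext (congrArg (fun V => V.1) h)
  have := V.2.2 x hx
  rw [semimap_eq_monomialMap hg] at this
  exact V.1.sub_mem this (V.1.smul_mem c hx)

lemma fixCount_le_of_isFresh [Fintype F] {q : ℕ} (hF : Fintype.card F = q) {g : SemiMon F n}
    {k κ : ℕ} (h : ∀ V : Submodule F (Fin n → F), finrank F V = k →
      ∀ W : Submodule F (Fin n → F), finrank F W + 2 + κ ≤ k →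
      q ^ (k - 4) ≤ Nat.card {x // x ∈ V ∧ IsFresh F (semimap g) W x}) :
    (fixCount k g : ℝ) ≤ (q : ℝ) ^ ((n : ℝ) ^ 2 / 8 + (κ + 3) * n) := by
  classical
  have : Fintype (Submodule F (Fin n → F)) := Fintype.ofFinite _
  have h1 := card_le_of_isFresh hF (semimap g)
    {V : Submodule F (Fin n → F) | finrank F V = k ∧ ∀ x ∈ V, semimap g x ∈ V}
    (k := k) (κ := κ) (fun V hV => (Finset.mem_filter.1 hV).2.1)
    (fun V hV => (Finset.mem_filter.1 hV).2.2)
    (fun V hV W _ => h V (Finset.mem_filter.1 hV).2.1 W)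
  rw [Module.finrank_fin_fun, ← Fintype.card_subtype, ← Nat.card_eq_fintype_card] at h1
  exact (Nat.cast_le.2 (fixCount_le g k)).trans h1

lemma fixCount_le_of_ne_one [Fintype F] {q : ℕ} (hF : Fintype.card F = q) {g : SemiMon F n}
    (hg : g.right.1 ≠ 1) (k : ℕ) :
    (fixCount k g : ℝ) ≤ (q : ℝ) ^ ((n : ℝ) ^ 2 / 8 + 3 * n) := by
  classical
  have h := fixCount_le_of_isFresh hF (g := g) (k := k) (κ := 0) fun V hV W hW => by
    rw [Nat.card_eq_fintype_card, Fintype.card_subtype, ← hV]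
    refine le_card_isFresh_of_semilinear hF (fun hσ => hg ?_) _ (semimap_injective g) (by omega)
    ext x
    exact RingHom.congr_fun hσ x
  simpa using h

lemma fixCount_le_of_finrank_ker_le [Fintype F] {q : ℕ} (hF : Fintype.card F = q)
    {g : SemiMon F n} (hg : g.right.1 = 1) {κ : ℕ}
    (hκ : ∀ c : F, finrank F (LinearMap.ker (monomialMap g - c • LinearMap.id)) ≤ κ) (k : ℕ) :
    (fixCount k g : ℝ) ≤ (q : ℝ) ^ ((n : ℝ) ^ 2 / 8 + (κ + 4) * n) := by
  classical
  have h := fixCount_le_of_isFresh hF (g := g) (k := k) (κ := κ + 1) fun V hV W hW => by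
    rw [Nat.card_eq_fintype_card, Fintype.card_subtype, ← hV,
      show ⇑(semimap g) = monomialMap g from funext (semimap_eq_monomialMap hg)]
    exact le_card_isFresh_of_linear hF _ hκ (by omega)
  refine h.trans_eq ?_
  push_cast
  ring_nf

/-- A bound for the number of subspaces fixed by a semilinear monomial map which is at distance
`r` from the scalars. -/
noncomputable def fixBound (q n r : ℕ) : ℝ :=
  ((n + 1) ^ 2 / Kq q ^ 2) * (q : ℝ) ^ ((n : ℝ) ^ 2 / 4 - r * n / 32)

lemma rpow_le_fixBound {q : ℕ} (hq : 2 ≤ q) {n r : ℕ} {t : ℝ}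
    (ht : t ≤ (n : ℝ) ^ 2 / 4 - r * n / 32) : (q : ℝ) ^ t ≤ fixBound q n r := by
  have h0 := Kq_pos hq
  have h1 : Kq q ≤ 1 := (Kq_le_KqTrunc hq 0).trans (KqTrunc_le_one hq 0)
  have hq1 : (1 : ℝ) ≤ q := by exact_mod_cast (by omega : 1 ≤ q)
  refine (Real.rpow_le_rpow_of_exponent_le hq1 ht).trans (le_mul_of_one_le_left (by positivity) ?_)
  rw [one_le_div (by positivity)]
  have : (0 : ℝ) ≤ n := n.cast_nonneg
  nlinarith

lemma subspaceBound_mul_le_fixBound {q : ℕ} (hq : 2 ≤ q) {n a b : ℕ} (hab : a + b = n)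
    (hb : n ≤ 16 * b) : subspaceBound q a * subspaceBound q b ≤ fixBound q n a := by
  have h0 := Kq_pos hq
  have hq1 : (1 : ℝ) ≤ q := by exact_mod_cast (by omega : 1 ≤ q)
  have hq0 : (0 : ℝ) < q := by positivity
  have hn : (n : ℝ) = a + b := by exact_mod_cast hab.symm
  have hb' : (n : ℝ) ≤ 16 * b := by exact_mod_cast hb
  have ha0 : (0 : ℝ) ≤ a := a.cast_nonneg
  have hb0 : (0 : ℝ) ≤ b := b.cast_nonneg
  calc subspaceBound q a * subspaceBound q b
      = ((a + 1) * (b + 1) / Kq q ^ 2) * (q : ℝ) ^ ((a : ℝ) ^ 2 / 4 + (b : ℝ) ^ 2 / 4) := by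
        rw [subspaceBound, subspaceBound, Real.rpow_add hq0]; field_simp
    _ ≤ fixBound q n a := by
        unfold fixBound
        gcongr ?_ / _ * ?_
        · rw [hn]; nlinarith
        · refine Real.rpow_le_rpow_of_exponent_le hq1 ?_
          rw [hn] at hb' ⊢
          nlinarith

lemma exists_fixCount_le [Fintype F] {q : ℕ} (hF : Fintype.card F = q) (hn : 128 ≤ n)
    {g : SemiMon F n} (hg : ¬ IsScalar g) (k : ℕ) :
    ∃ r, 1 ≤ r ∧ r ≤ n ∧ (∃ c, (moved g c).card ≤ 2 * r) ∧
      (fixCount k g : ℝ) ≤ fixBound q n r := by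
  have hq : 2 ≤ q := hF ▸ Fintype.one_lt_card
  have hn' : (128 : ℝ) ≤ n := by exact_mod_cast hn
  by_cases hσ : g.right.1 = 1
  · obtain ⟨c, hc⟩ := Finite.exists_min fun c : Fˣ =>
      finrank F (LinearMap.range (monomialMap g - (c : F) • LinearMap.id))
    have hrk := fun a : F =>
      LinearMap.finrank_range_add_finrank_ker (monomialMap g - a • LinearMap.id)
    simp only [Module.finrank_fin_fun] at hrk
    set r := finrank F (LinearMap.range (monomialMap g - (c : F) • LinearMap.id)) with hr
    have hmoved := card_moved_le_two_mul_finrank g c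
    have hrn : r ≤ n := by have := hrk c; omega
    refine ⟨r, ?_, hrn, ⟨c, hmoved⟩, ?_⟩
    · by_contra! hr0
      have hempty : moved g c = ∅ := Finset.card_eq_zero.1 (by omega)
      have hfix : ∀ i, g.right.2 i = i ∧ g.left i = c := fun i => by
        have : i ∉ moved g c := by simp [hempty]
        rwa [mem_moved, not_not] at this
      exact hg ⟨Prod.ext hσ (Equiv.ext fun i => (hfix i).1), c, fun i => (hfix i).2⟩
    · by_cases hcase : n ≤ 16 * (n - r)
      · refine (fixCount_le_subspaceBound hF hσ c k).trans ?_
        have := hrk c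
        exact subspaceBound_mul_le_fixBound hq this (by omega)
      · refine (fixCount_le_of_finrank_ker_le hF hσ (κ := n - r) (fun a => ?_) k).trans
          (rpow_le_fixBound hq ?_)
        · rcases eq_or_ne a 0 with rfl | ha
          · rw [zero_smul, sub_zero, LinearMap.ker_eq_bot.2 (monomialMap_injective g)]
            simp
          · have h1 := hc (Units.mk0 a ha)
            have h2 := hrk a
            rw [Units.val_mk0] at h1
            omega
        · have h1 : ((n - r : ℕ) : ℝ) ≤ n / 16 := by
            rw [le_div_iff₀ (by norm_num)]
            exact_mod_cast (by omega : (n - r) * 16 ≤ n)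
          have h2 : (r : ℝ) ≤ n := by exact_mod_cast hrn
          nlinarith
  · refine ⟨n, by omega, le_rfl, ⟨1, (Finset.card_le_univ _).trans ?_⟩,
      (fixCount_le_of_ne_one hF hσ k).trans (rpow_le_fixBound hq (by nlinarith))⟩
    rw [Fintype.card_fin]; omega

end FixedPoints

section Asymptotics

open Module

/-- A bound for the contribution of the nonscalar elements to Burnside's sum. -/
noncomputable def nonscalarBound (q h n : ℕ) : ℝ :=
  ∑ r ∈ Finset.Icc 1 n, (q * h * (n ^ 2 * q) ^ (2 * r) : ℕ) * fixBound q n r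

lemma fixBound_nonneg (q n r : ℕ) : 0 ≤ fixBound q n r := by
  unfold fixBound; positivity

lemma numClassesDimSemi_bounds {F : Type} [Field F] [Fintype F] {q h n : ℕ}
    (hF : Fintype.card F = q) (hh : Nat.card (F ≃+* F) = h) (hn : 128 ≤ n) (k : ℕ) :
    ∃ e : ℝ, 0 ≤ e ∧ e ≤ nonscalarBound q h n ∧
      (numClassesDimSemi F n k : ℝ) * (((q : ℝ) - 1) ^ n * (h * n.factorial)) =
        ((q : ℝ) - 1) * Nat.card {V : Submodule F (Fin n → F) // finrank F V = k} + e := by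
  classical
  have hq : 2 ≤ q := hF ▸ Fintype.one_lt_card
  let _ : Fintype (SemiMon F n) := Fintype.ofFinite _
  refine ⟨∑ g : SemiMon F n with ¬ IsScalar g, (fixCount k g : ℝ), by positivity, ?_, ?_⟩
  · calc ∑ g : SemiMon F n with ¬ IsScalar g, (fixCount k g : ℝ)
        ≤ ∑ g : SemiMon F n with ¬ IsScalar g, ∑ r ∈ Finset.Icc 1 n,
            if ∃ c, (moved g c).card ≤ 2 * r then fixBound q n r else 0 := by
          refine Finset.sum_le_sum fun g hg => ?_
          obtain ⟨r, h1, h2, h3, h4⟩ :=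
            exists_fixCount_le hF hn (Finset.mem_filter.1 hg).2 k
          refine (h4.trans_eq (if_pos h3).symm).trans (Finset.single_le_sum
            (f := fun r => if ∃ c, (moved g c).card ≤ 2 * r then fixBound q n r else 0)
            (fun r _ => ?_) (Finset.mem_Icc.2 ⟨h1, h2⟩))
          split_ifs
          exacts [fixBound_nonneg _ _ _, le_rfl]
      _ ≤ ∑ g : SemiMon F n, ∑ r ∈ Finset.Icc 1 n,
            if ∃ c, (moved g c).card ≤ 2 * r then fixBound q n r else 0 := by
          refine Finset.sum_le_sum_of_subset_of_nonneg (Finset.filter_subset _ _) fun g _ _ =>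
            Finset.sum_nonneg fun r _ => ?_
          split_ifs
          exacts [fixBound_nonneg _ _ _, le_rfl]
      _ ≤ nonscalarBound q h n := by
          rw [Finset.sum_comm]
          refine Finset.sum_le_sum fun r _ => ?_
          rw [← Finset.sum_filter, Finset.sum_const, nsmul_eq_mul]
          refine mul_le_mul_of_nonneg_right (Nat.cast_le.2 ?_) (fixBound_nonneg _ _ _)
          rw [← Fintype.card_subtype, ← Nat.card_eq_fintype_card]
          exact card_moved_le hF hh (by omega) _
  · have h1 := congrArg (Nat.cast (R := ℝ)) (numClassesDimSemi_mul_card (F := F) (n := n) k)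
    rw [card_semiMon hF hh, Nat.cast_sum,
      ← Finset.sum_filter_add_sum_filter_not Finset.univ IsScalar,
      Finset.sum_congr rfl fun g hg => by
        rw [fixCount_of_isScalar (Finset.mem_filter.1 hg).2],
      Finset.sum_const, ← Fintype.card_subtype, ← Nat.card_eq_fintype_card,
      card_isScalar hF (by omega), nsmul_eq_mul] at h1
    push_cast [Nat.cast_sub (by omega : 1 ≤ q)] at h1
    exact h1

lemma tendsto_pow_mul_rpow {q : ℕ} (hq : 2 ≤ q) (j : ℕ) :
    Tendsto (fun n : ℕ => (n : ℝ) ^ j * (q : ℝ) ^ (-(n : ℝ) / 64)) atTop (𝓝 0) := by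
  have hq1 : (1 : ℝ) < q := by exact_mod_cast hq
  have h := tendsto_pow_const_mul_const_pow_of_abs_lt_one j
    (r := (q : ℝ) ^ (-(1 : ℝ) / 64)) (by
      rw [abs_of_pos (by positivity)]
      exact Real.rpow_lt_one_of_one_lt_of_neg hq1 (by norm_num))
  refine h.congr fun n => ?_
  rw [← Real.rpow_natCast ((q : ℝ) ^ (-(1 : ℝ) / 64)) n, ← Real.rpow_mul (by positivity)]
  congr 2
  ring

lemma tendsto_nonscalarBound {q : ℕ} (hq : 2 ≤ q) (h : ℕ) :
    Tendsto (fun n : ℕ => nonscalarBound q h n / (q : ℝ) ^ ((n : ℝ) ^ 2 / 4 - n / 64))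
      atTop (𝓝 0) := by
  have hK := Kq_pos hq
  have hq1 : (1 : ℝ) < q := by exact_mod_cast hq
  have hq0 : (0 : ℝ) < q := by positivity
  have hx : ∀ᶠ n : ℕ in atTop, ((n : ℝ) ^ 2 * q) ^ 2 * (q : ℝ) ^ (-(n : ℝ) / 64) ≤ 1 := by
    have h1 := (tendsto_pow_mul_rpow hq 4).const_mul ((q : ℝ) ^ 2)
    rw [mul_zero] at h1
    filter_upwards [h1.eventually_le_const one_pos] with n hn
    refine le_trans (le_of_eq ?_) hn
    ring
  have hlim := (tendsto_pow_mul_rpow hq 7).const_mul (4 * q ^ 3 * h / Kq q ^ 2 : ℝ)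
  rw [mul_zero] at hlim
  refine squeeze_zero' (Eventually.of_forall fun n => ?_) ?_ hlim
  · exact div_nonneg (Finset.sum_nonneg fun r _ =>
      mul_nonneg (Nat.cast_nonneg _) (fixBound_nonneg _ _ _)) (by positivity)
  · filter_upwards [hx, eventually_ge_atTop 1] with n hx hn
    have hn1 : (1 : ℝ) ≤ n := by exact_mod_cast hn
    set x := ((n : ℝ) ^ 2 * q) ^ 2 * (q : ℝ) ^ (-(n : ℝ) / 64) with hxdef
    have hx0 : 0 ≤ x := by positivity
    rw [div_le_iff₀ (by positivity), nonscalarBound]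
    have hterm : ∀ r ∈ Finset.Icc 1 n,
        ((q * h * (n ^ 2 * q) ^ (2 * r) : ℕ) : ℝ) * fixBound q n r ≤
          q * h * ((2 * n) ^ 2 / Kq q ^ 2) * x * (q : ℝ) ^ ((n : ℝ) ^ 2 / 4 - n / 64) := by
      intro r hr
      have hr1 := (Finset.mem_Icc.1 hr).1
      have hr1' : (1 : ℝ) ≤ r := by exact_mod_cast hr1
      have hsplit : (q : ℝ) ^ ((n : ℝ) ^ 2 / 4 - r * n / 32) ≤
          ((q : ℝ) ^ (-(n : ℝ) / 64)) ^ r * (q : ℝ) ^ ((n : ℝ) ^ 2 / 4 - n / 64) := by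
        rw [← Real.rpow_natCast ((q : ℝ) ^ (-(n : ℝ) / 64)), ← Real.rpow_mul hq0.le,
          ← Real.rpow_add hq0]
        exact Real.rpow_le_rpow_of_exponent_le hq1.le (by nlinarith)
      have hxr : x ^ r ≤ x := pow_le_of_le_one hx0 hx (by omega)
      calc ((q * h * (n ^ 2 * q) ^ (2 * r) : ℕ) : ℝ) * fixBound q n r
          ≤ q * h * ((n : ℝ) ^ 2 * q) ^ (2 * r) * (((2 * n) ^ 2 / Kq q ^ 2) *
            (((q : ℝ) ^ (-(n : ℝ) / 64)) ^ r * (q : ℝ) ^ ((n : ℝ) ^ 2 / 4 - n / 64))) := by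
            unfold fixBound
            push_cast
            gcongr
            linarith
        _ = q * h * ((2 * n) ^ 2 / Kq q ^ 2) * x ^ r *
            (q : ℝ) ^ ((n : ℝ) ^ 2 / 4 - n / 64) := by
            rw [hxdef, mul_pow, ← pow_mul]; ring
        _ ≤ _ := by gcongr
    refine (Finset.sum_le_sum hterm).trans (le_of_eq ?_)
    rw [Finset.sum_const, Nat.card_Icc, nsmul_eq_mul, hxdef, Nat.add_sub_cancel]
    ring

/-- If `k (n - k)` is within `n / 64` of its maximum then `k` and `n - k` are at least `n / 4`. -/
lemma div_four_le_of_sq_le {n k : ℝ} (hn : 1 ≤ n) (h : n ^ 2 / 4 - n / 64 ≤ k * (n - k)) :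
    n / 4 ≤ k ∧ n / 4 ≤ n - k := by
  constructor <;> by_contra! <;> nlinarith

lemma tendsto_card_grassmannian_div {q : ℕ} (F : Type) [Field F] [Fintype F]
    (hF : Fintype.card F = q) {k : ℕ → ℕ} (hk : ∀ n, k n ≤ n) (h1 : Tendsto k atTop atTop)
    (h2 : Tendsto (fun n => n - k n) atTop atTop) :
    Tendsto (fun n : ℕ => (Nat.card {V : Submodule F (Fin n → F) // finrank F V = k n} : ℝ) /
      (q : ℝ) ^ (k n * (n - k n))) atTop (𝓝 (Kq q)⁻¹) := by
  have hq : 2 ≤ q := hF ▸ Fintype.one_lt_card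
  have hK := Kq_pos hq
  have hT := tendsto_KqTrunc hq
  have h3 := hT.div ((hT.comp h2).mul (hT.comp h1)) (by positivity)
  have h4 : Kq q / (Kq q * Kq q) = (Kq q)⁻¹ := by field_simp
  rw [h4] at h3
  refine h3.congr fun n => ?_
  have hq0 : (0 : ℝ) < q := by positivity
  have h5 := card_grassmannian (E := Fin n → F) hF (k n) (by simpa using hk n)
  rw [Module.finrank_fin_fun] at h5
  rw [h5, mul_div_cancel_left₀ _ (by positivity)]
  rfl

end Asymptotics

theorem stmt11 (q p h : ℕ) (hp : p.Prime) (hh : 1 ≤ h) (hqph : q = p ^ h)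
    (F : Type) [Field F] [Fintype F] (hq : Fintype.card F = q) :
    ∃ A > (0 : ℝ), ∃ ε > (0 : ℝ), ∀ k : ℕ → ℕ, (∀ n, k n ≤ n) → StarCond A ε k →
      Tendsto (fun n : ℕ => (numClassesDimSemi F n (k n) : ℝ) /
          ((q : ℝ) ^ (k n * (n - k n)) /
            (Kq q * (h : ℝ) * (n.factorial : ℝ) * ((q : ℝ) - 1) ^ (n - 1))))
        atTop (𝓝 1) := by
  refine ⟨1, one_pos, 1 / 64, by norm_num, fun k hk hstar => ?_⟩
  have hq2 : 2 ≤ q := hq ▸ Fintype.one_lt_card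
  have hq2' : (2 : ℝ) ≤ q := by exact_mod_cast hq2
  have hK := Kq_pos hq2
  have hcard := card_ringAut (F := F) hp (hq.trans hqph)
  have hdim : ∀ᶠ n : ℕ in atTop, (n : ℝ) ^ 2 / 4 - n / 64 ≤ (k n : ℝ) * (n - k n) := by
    filter_upwards [hstar.eventually_le_atBot 0] with n hn
    have := Real.sqrt_nonneg n
    linarith
  have hquarter : ∀ᶠ n : ℕ in atTop, n / 4 ≤ k n ∧ n / 4 ≤ n - k n := by
    filter_upwards [hdim, eventually_ge_atTop 1] with n hn hn1
    obtain ⟨h1, h2⟩ := div_four_le_of_sq_le (by exact_mod_cast hn1) hn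
    have h1' : (n : ℝ) ≤ (k n * 4 : ℕ) := by push_cast; linarith
    have h2' : (n : ℝ) ≤ ((n - k n) * 4 : ℕ) := by
      push_cast [Nat.cast_sub (hk n)]; linarith
    exact ⟨Nat.div_le_of_le_mul (by rw [mul_comm]; exact_mod_cast h1'),
      Nat.div_le_of_le_mul (by rw [mul_comm]; exact_mod_cast h2')⟩
  have hdiv : Tendsto (fun n : ℕ => n / 4) atTop atTop :=
    Nat.tendsto_div_const_atTop (by norm_num)
  have hmain := tendsto_card_grassmannian_div F hq hk
    (tendsto_atTop_mono' _ (hquarter.mono fun n hn => hn.1) hdiv)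
    (tendsto_atTop_mono' _ (hquarter.mono fun n hn => hn.2) hdiv)
  have hlow := hmain.const_mul (Kq q)
  have hup := (hmain.add (tendsto_nonscalarBound hq2 h)).const_mul (Kq q)
  rw [add_zero] at hup
  rw [mul_inv_cancel₀ hK.ne'] at hlow hup
  have hratio : ∀ᶠ n : ℕ in atTop, ∃ e : ℝ, 0 ≤ e ∧
      e ≤ nonscalarBound q h n / (q : ℝ) ^ ((n : ℝ) ^ 2 / 4 - n / 64) ∧
      (numClassesDimSemi F n (k n) : ℝ) / ((q : ℝ) ^ (k n * (n - k n)) /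
        (Kq q * (h : ℝ) * (n.factorial : ℝ) * ((q : ℝ) - 1) ^ (n - 1))) =
      Kq q * ((Nat.card {V : Submodule F (Fin n → F) // Module.finrank F V = k n} : ℝ) /
        (q : ℝ) ^ (k n * (n - k n)) + e) := by
    filter_upwards [hdim, eventually_ge_atTop 128] with n hn hn1
    obtain ⟨e, he0, he1, he⟩ := numClassesDimSemi_bounds hq hcard hn1 (k n)
    have hQ : (q : ℝ) ^ ((n : ℝ) ^ 2 / 4 - n / 64) ≤ (q : ℝ) ^ (k n * (n - k n)) := by
      rw [← Real.rpow_natCast (q : ℝ)]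
      refine Real.rpow_le_rpow_of_exponent_le (one_le_two.trans hq2') ?_
      push_cast [Nat.cast_sub (hk n)]
      exact hn
    have hq1 : (0 : ℝ) < q - 1 := by linarith
    refine ⟨e / (q - 1) / (q : ℝ) ^ (k n * (n - k n)), by positivity, ?_, ?_⟩
    · refine div_le_div₀ (he0.trans he1) ?_ (by positivity) hQ
      exact (div_le_self he0 (by linarith)).trans he1
    · have hpow : ((q : ℝ) - 1) ^ n = (q - 1) ^ (n - 1) * (q - 1) := by
        rw [← pow_succ, Nat.sub_add_cancel (by omega)]
      rw [hpow] at he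
      field_simp
      linear_combination he
  refine tendsto_of_tendsto_of_tendsto_of_le_of_le' hlow hup ?_ ?_
  · filter_upwards [hratio] with n hn
    obtain ⟨e, he0, -, he⟩ := hn
    rw [he]
    gcongr
    linarith
  · filter_upwards [hratio] with n hn
    obtain ⟨e, -, he1, he⟩ := hn
    rw [he]
    gcongr
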